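/- In the first order setting, let x ∈ D₂ be the exact solution of A₂x = f, A₁*x = g, πx = k, let x̃ ∈ H₂ be arbitrary, and set e := x − x̃ and e_{A₁} := π_{R(A₁)}e. Then ‖e_{A₁}‖²_{H₂} = max over φ ∈ D(A₁) of ( 2⟨g, φ⟩_{H₁} − ⟨2x̃ + A₁φ, A₁φ⟩_{H₂} ), and the maximum is attained at the unique φ̂ ∈ D(A₁) ∩ N(A₁)^⊥ with A₁φ̂ = e_{A₁}. -/

import Mathlib

open Submodule LinearPMap RealInnerProductSpace

noncomputable section

/-- The range of a partially defined linear operator, as a submodule. -/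
def pRan {E F : Type*} [AddCommGroup E] [Module ℝ E] [AddCommGroup F] [Module ℝ F]
    (A : E →ₗ.[ℝ] F) : Submodule ℝ F :=
  LinearMap.range A.toFun

/-- The kernel of a partially defined linear operator, as a submodule of the ambient space. -/
def pKer {E F : Type*} [AddCommGroup E] [Module ℝ E] [AddCommGroup F] [Module ℝ F]
    (A : E →ₗ.[ℝ] F) : Submodule ℝ E :=
  (LinearMap.ker A.toFun).map A.domain.subtype

variable {H₁ H₂ H₃ : Type*}
  [NormedAddCommGroup H₁] [InnerProductSpace ℝ H₁] [CompleteSpace H₁]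
  [NormedAddCommGroup H₂] [InnerProductSpace ℝ H₂] [CompleteSpace H₂]
  [NormedAddCommGroup H₃] [InnerProductSpace ℝ H₃] [CompleteSpace H₃]

theorem mem_pKer_iff {E F : Type*} [AddCommGroup E] [Module ℝ E] [AddCommGroup F] [Module ℝ F]
    {A : E →ₗ.[ℝ] F} {u : E} : u ∈ pKer A ↔ ∃ h : u ∈ A.domain, A ⟨u, h⟩ = 0 := by
  simp [pKer]

theorem pKer_eq_comap_graph {E F : Type*} [AddCommGroup E] [Module ℝ E] [AddCommGroup F]
    [Module ℝ F] (A : E →ₗ.[ℝ] F) : pKer A = A.graph.comap (LinearMap.inl ℝ E F) := by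
  ext u
  simp [mem_pKer_iff, LinearPMap.mem_graph_iff]

theorem isClosed_pKer {E F : Type*} [NormedAddCommGroup E] [NormedSpace ℝ E]
    [NormedAddCommGroup F] [NormedSpace ℝ F] {A : E →ₗ.[ℝ] F} (hA : A.IsClosed) :
    IsClosed (pKer A : Set E) := by
  rw [pKer_eq_comap_graph]
  exact IsClosed.preimage (f := fun u : E => (u, (0 : F))) (by fun_prop) hA

/-- Every value of a closed operator is attained at exactly one point of the domain orthogonal to
the kernel. -/
theorem existsUnique_mem_pKer_orthogonal {E F : Type*} [NormedAddCommGroup E]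
    [InnerProductSpace ℝ E] [CompleteSpace E] [NormedAddCommGroup F] [NormedSpace ℝ F]
    {A : E →ₗ.[ℝ] F} (hA : A.IsClosed) {y : F} (hy : y ∈ pRan A) :
    ∃! φ : A.domain, (φ : E) ∈ (pKer A)ᗮ ∧ A φ = y := by
  have : CompleteSpace (pKer A) := (isClosed_pKer hA).completeSpace_coe
  obtain ⟨ψ, hψ⟩ : ∃ ψ : A.domain, A ψ = y := hy
  obtain ⟨hdom, hzero⟩ := mem_pKer_iff.1 ((pKer A).starProjection_apply_mem (ψ : E))
  refine ⟨ψ - ⟨_, hdom⟩, ⟨(pKer A).sub_starProjection_mem_orthogonal (ψ : E), ?_⟩, ?_⟩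
  · rw [LinearPMap.map_sub, hzero, hψ, sub_zero]
  · rintro φ ⟨hφ, hφy⟩
    set χ : A.domain := ψ - ⟨_, hdom⟩ with hχ
    have hχperp : (χ : E) ∈ (pKer A)ᗮ := (pKer A).sub_starProjection_mem_orthogonal (ψ : E)
    have hker : ((φ - χ : A.domain) : E) ∈ pKer A :=
      mem_pKer_iff.2 ⟨(φ - χ).2, by
        change A (φ - χ) = 0
        rw [LinearPMap.map_sub, hφy, hχ, LinearPMap.map_sub, hzero, hψ, sub_zero, sub_self]⟩
    have hzero' : ((φ - χ : A.domain) : E) = 0 :=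
      inner_self_eq_zero.1 ((pKer A).inner_right_of_mem_orthogonal hker (sub_mem hφ hχperp))
    exact sub_eq_zero.1 (Subtype.ext hzero')

/-- Completing the square in the lower bound functional. -/
theorem lowerBound_eq_norm_sq_sub {E F : Type*} [NormedAddCommGroup E] [InnerProductSpace ℝ E]
    [CompleteSpace E] [NormedAddCommGroup F] [InnerProductSpace ℝ F]
    {A : E →ₗ.[ℝ] F} (hdense : Dense (A.domain : Set E)) (x : (A†).domain) {xt e : F}
    (he : (x : F) - xt - e ∈ (pRan A)ᗮ) (φ : A.domain) :
    2 * ⟪A† x, (φ : E)⟫ - ⟪(2 : ℝ) • xt + A φ, A φ⟫ = ‖e‖ ^ 2 - ‖e - A φ‖ ^ 2 := by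
  have hadj : ⟪A† x, (φ : E)⟫ = ⟪(x : F), A φ⟫ := LinearPMap.adjoint_isFormalAdjoint hdense x φ
  have hperp : ⟪(x : F) - xt - e, A φ⟫ = 0 :=
    (pRan A).inner_left_of_mem_orthogonal ⟨φ, rfl⟩ he
  rw [inner_sub_left, inner_sub_left] at hperp
  rw [hadj, norm_sub_sq_real, inner_add_left, real_inner_smul_left, real_inner_self_eq_norm_sq]
  linarith

/-- Functional a posteriori error estimate, lower bound for the `R(A₁)` part
of the error: with `e = x - xt` and `e_{A₁} = π_{R(A₁)} e`,
`‖e_{A₁}‖² = max_{φ ∈ D(A₁)} ( 2⟪g, φ⟫ - ⟪2xt + A₁φ, A₁φ⟫ )`, the maximum being attained at the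
unique `φ̂ ∈ D(A₁) ∩ N(A₁)^⊥` with `A₁ φ̂ = e_{A₁}`. -/
theorem statement14 (A₁ : H₁ →ₗ.[ℝ] H₂) (A₂ : H₂ →ₗ.[ℝ] H₃)
    (hdense₁ : Dense (A₁.domain : Set H₁)) (hdense₂ : Dense (A₂.domain : Set H₂))
    (hclosed₁ : A₁.IsClosed) (hclosed₂ : A₂.IsClosed)
    (hcomplex : pRan A₁ ≤ pKer A₂)
    (hrange₁ : IsClosed (pRan A₁ : Set H₂)) (hrange₂ : IsClosed (pRan A₂ : Set H₃))
    (f : H₃) (g : H₁) (k : H₂)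
    (hf : f ∈ pRan A₂) (hg : g ∈ pRan (A₁†)) (hk : k ∈ pKer A₂ ⊓ pKer (A₁†))
    -- `x ∈ D₂` is the exact solution: `A₂ x = f`, `A₁† x = g`, `π x = k`
    (x : H₂) (hx₂ : x ∈ A₂.domain) (hx₁ : x ∈ (A₁†).domain)
    (hxf : A₂ ⟨x, hx₂⟩ = f) (hxg : A₁† ⟨x, hx₁⟩ = g)
    (hxk : x - k ∈ (pKer A₂ ⊓ pKer (A₁†))ᗮ)
    -- `xt` is an arbitrary (possibly nonconforming) approximation
    (xt : H₂)
    -- `eA₁ = π_{R(A₁)} (x - xt)`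
    (eA₁ : H₂) (heA₁ : eA₁ ∈ pRan A₁) (heA₁perp : (x - xt) - eA₁ ∈ (pRan A₁)ᗮ) :
    IsGreatest {r : ℝ | ∃ φ : A₁.domain,
      r = 2 * ⟪g, (φ : H₁)⟫ - ⟪(2 : ℝ) • xt + A₁ φ, A₁ φ⟫} (‖eA₁‖ ^ 2)
    ∧ ∃ φ : A₁.domain, (φ : H₁) ∈ (pKer A₁)ᗮ ∧ A₁ φ = eA₁
        ∧ 2 * ⟪g, (φ : H₁)⟫ - ⟪(2 : ℝ) • xt + A₁ φ, A₁ φ⟫ = ‖eA₁‖ ^ 2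
        ∧ (∀ φ' : A₁.domain, (φ' : H₁) ∈ (pKer A₁)ᗮ → A₁ φ' = eA₁ → φ' = φ) := by
  subst hxg
  have hval := lowerBound_eq_norm_sq_sub hdense₁ ⟨x, hx₁⟩ heA₁perp
  obtain ⟨φ, ⟨hφ, hφe⟩, huniq⟩ := existsUnique_mem_pKer_orthogonal hclosed₁ heA₁
  have hmax : 2 * ⟪A₁† ⟨x, hx₁⟩, (φ : H₁)⟫ - ⟪(2 : ℝ) • xt + A₁ φ, A₁ φ⟫ = ‖eA₁‖ ^ 2 := by
    rw [hval, hφe]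
    simp
  refine ⟨⟨⟨φ, hmax.symm⟩, ?_⟩, φ, hφ, hφe, hmax, fun φ' h h' => huniq φ' ⟨h, h'⟩⟩
  rintro r ⟨ψ, rfl⟩
  rw [hval]
  exact sub_le_self _ (sq_nonneg _)
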